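/- arXiv:2509.23078 — 3 statements merged into one kernel-verified Lean document; each statement's English description precedes it below -/
import Mathlib

section
/- Stiebitz's theorem: Let G be a finite simple graph and let a, b : V(G) → ℤ≥0 be functions such that d_G(u) ≥ a(u) + b(u) + 1 for every vertex u. Then V(G) admits a partition (A, B) into two non-empty sets such that every vertex u ∈ A has at least a(u) neighbors in A, and every vertex v ∈ B has at least b(v) neighbors in B. -/
namespace StiebitzAux

variable {V : Type*} [Fintype V] [DecidableEq V] (G : SimpleGraph V) [DecidableRel G.Adj]

/-- Number of neighbours of `u` in `A`. -/
def dg (A : Finset V) (u : V) : ℕ := (A.filter (G.Adj u)).card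

/-- Every nonempty subset has a vertex of small degree. -/
def Dgen (a : V → ℕ) (A : Finset V) : Prop :=
  ∀ X ⊆ A, X.Nonempty → ∃ x ∈ X, dg G X x ≤ a x

/-- The (doubled) weight of the partition `(A, Aᶜ)`. -/
def W (a b : V → ℕ) (A : Finset V) : ℕ :=
  ∑ u ∈ A, dg G A u + ∑ u ∈ Aᶜ, dg G Aᶜ u + 2 * ∑ u ∈ A, b u + 2 * ∑ u ∈ Aᶜ, a u

lemma dg_insert {A : Finset V} {x : V} (hx : x ∉ A) (u : V) :
    dg G (insert x A) u = dg G A u + if G.Adj u x then 1 else 0 := by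
  unfold dg
  rw [Finset.filter_insert]
  split_ifs with h
  · rw [Finset.card_insert_of_notMem (by simp [hx])]
  · rfl

lemma dg_mono {A B : Finset V} (h : A ⊆ B) (u : V) : dg G A u ≤ dg G B u :=
  Finset.card_le_card (Finset.filter_subset_filter _ h)

lemma dg_erase (A : Finset V) (x u : V) : dg G A u ≤ dg G (A.erase x) u + 1 := by
  by_cases hx : x ∈ A
  · have := dg_insert G (Finset.notMem_erase x A) u
    rw [Finset.insert_erase hx] at this
    split_ifs at this <;> omega
  · rw [Finset.erase_eq_of_notMem hx]; omega

lemma dg_univ (u : V) : dg G Finset.univ u = G.degree u := by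
  unfold dg
  rw [← G.card_neighborFinset_eq_degree, G.neighborFinset_eq_filter]

lemma dg_union {A B : Finset V} (h : Disjoint A B) (u : V) :
    dg G (A ∪ B) u = dg G A u + dg G B u := by
  unfold dg
  rw [Finset.filter_union, Finset.card_union_of_disjoint
    (Finset.disjoint_filter_filter h)]

lemma dg_compl (A : Finset V) (u : V) : dg G A u + dg G Aᶜ u = G.degree u := by
  rw [← dg_union G disjoint_compl_right, Finset.union_compl, dg_univ]

lemma sum_insert {A : Finset V} {x : V} (hx : x ∉ A) :
    ∑ u ∈ insert x A, dg G (insert x A) u = ∑ u ∈ A, dg G A u + 2 * dg G A x := by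
  rw [Finset.sum_insert hx, dg_insert G hx]
  simp only [dg_insert G hx, Finset.sum_add_distrib]
  have : ∑ u ∈ A, (if G.Adj u x then 1 else 0) = dg G A x := by
    unfold dg
    rw [Finset.card_filter]
    simp only [G.adj_comm]
  rw [this]
  simp
  ring

lemma W_compl (a b : V → ℕ) (A : Finset V) : W G b a Aᶜ = W G a b A := by
  unfold W
  rw [compl_compl]
  ring

lemma W_lt (a b : V → ℕ) (hdeg : ∀ u : V, a u + b u + 1 ≤ G.degree u)
    {A : Finset V} {x : V} (hx : x ∈ A) (h : dg G A x ≤ a x) :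
    W G a b A < W G a b (A.erase x) := by
  have hx' : x ∉ A.erase x := Finset.notMem_erase x A
  have hxc : x ∉ Aᶜ := by simpa using hx
  have h1 := sum_insert G hx'
  have h2 := sum_insert G hxc
  have h3 := dg_compl G A x
  have h4 := hdeg x
  have h5 := dg_mono G (Finset.erase_subset x A) x
  have h6 := Finset.sum_insert (f := b) hx'
  have h7 := Finset.sum_insert (f := a) hxc
  rw [Finset.insert_erase hx] at h1 h6
  unfold W
  rw [Finset.compl_erase]
  omega

lemma half [Nonempty V] (a b : V → ℕ) (hdeg : ∀ u : V, a u + b u + 1 ≤ G.degree u)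
    {A : Finset V} (hA : Dgen G a A) (hB : Dgen G b Aᶜ)
    (hmax : ∀ A' : Finset V, Dgen G a A' → Dgen G b A'ᶜ → W G a b A' ≤ W G a b A) :
    ∃ x ∈ A, ∃ B' ⊆ insert x Aᶜ, x ∈ B' ∧ ∀ v ∈ B', b v + 1 ≤ dg G B' v := by
  by_cases hne : A.Nonempty
  · obtain ⟨x, hx, hdx⟩ := hA A subset_rfl hne
    refine ⟨x, hx, ?_⟩
    by_contra! hcon
    have := hmax (A.erase x)
      (fun X hX => hA X (hX.trans (Finset.erase_subset _ _))) ?_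
    · exact absurd (W_lt G a b hdeg hx hdx) (by omega)
    · rw [Finset.compl_erase]
      intro X hX hXn
      by_cases hxX : x ∈ X
      · obtain ⟨v, hv, hv'⟩ := hcon X hX hxX
        exact ⟨v, hv, by omega⟩
      · exact hB X ((Finset.subset_insert_iff_of_notMem hxX).1 hX) hXn
  · rw [Finset.not_nonempty_iff_eq_empty] at hne
    subst hne
    obtain ⟨x, _, hx⟩ := hB Finset.univ (by simp) Finset.univ_nonempty
    have := hdeg x
    rw [dg_univ] at hx
    omega

/-- A feasible pair exists. -/
lemma exists_pair [Nonempty V] (a b : V → ℕ) (hdeg : ∀ u : V, a u + b u + 1 ≤ G.degree u) :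
    ∃ A B : Finset V, A.Nonempty ∧ B.Nonempty ∧ Disjoint A B ∧
      (∀ u ∈ A, a u ≤ dg G A u) ∧ (∀ v ∈ B, b v ≤ dg G B v) := by
  classical
  by_cases hcase : ∃ A : Finset V, Dgen G a A ∧ Dgen G b Aᶜ
  · obtain ⟨A0, h0⟩ := hcase
    obtain ⟨A, hA, hmax⟩ := Finset.exists_max_image
      (Finset.univ.filter fun A : Finset V => Dgen G a A ∧ Dgen G b Aᶜ) (W G a b)
      ⟨A0, by simpa using h0⟩
    simp only [Finset.mem_filter, Finset.mem_univ, true_and] at hA hmax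
    obtain ⟨x, hx, B', hB', hxB, hB⟩ := half G a b hdeg hA.1 hA.2
      (fun A' h1 h2 => hmax A' ⟨h1, h2⟩)
    obtain ⟨y, hy, A', hA', hyA, hAA⟩ := half G b a
      (fun u => by have := hdeg u; omega) (A := Aᶜ) hA.2 (by rw [compl_compl]; exact hA.1)
      (fun C h1 h2 => by
        have h3 := hmax Cᶜ ⟨h2, by rwa [compl_compl]⟩
        rw [W_compl]
        rwa [W_compl] at h3)
    rw [compl_compl] at hA'
    have hy' : y ∉ A := by simpa using hy
    have hxy : x ≠ y := fun h => hy' (h ▸ hx)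
    refine ⟨A'.erase x, B'.erase y, ⟨y, by simp [hyA, hxy.symm]⟩, ⟨x, by simp [hxB, hxy]⟩,
      ?_, ?_, ?_⟩
    · rw [Finset.disjoint_left]
      intro z hz hz'
      simp only [Finset.mem_erase] at hz hz'
      have h1 := hA' hz.2
      have h2 := hB' hz'.2
      simp only [Finset.mem_insert, Finset.mem_compl] at h1 h2
      tauto
    · intro u hu
      have := hAA u (Finset.mem_of_mem_erase hu)
      have := dg_erase G A' x u
      omega
    · intro u hu
      have := hB u (Finset.mem_of_mem_erase hu)
      have := dg_erase G B' y u
      omega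
  · obtain ⟨A, hA, hmin⟩ := Finset.exists_min_image
      (Finset.univ.filter fun A : Finset V => A.Nonempty ∧ ∀ u ∈ A, a u ≤ dg G A u)
      Finset.card ⟨Finset.univ, by
        simp only [Finset.mem_filter, Finset.mem_univ, true_and, Finset.univ_nonempty, dg_univ]
        intro u _
        have := hdeg u
        omega⟩
    simp only [Finset.mem_filter, Finset.mem_univ, true_and] at hA hmin
    have hAd : Dgen G a A := by
      intro X hX hXn
      by_contra! hcon
      obtain ⟨x, hx⟩ := hXn
      have h1 := hmin (X.erase x) ⟨?_, ?_⟩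
      · have h2 := Finset.card_erase_lt_of_mem hx
        have h3 := Finset.card_le_card hX
        omega
      · have h2 := hcon x hx
        have h3 : 0 < dg G X x := by omega
        obtain ⟨z, hz⟩ := Finset.card_pos.1 h3
        rw [Finset.mem_filter] at hz
        exact ⟨z, by simp [hz.1, hz.2.ne']⟩
      · intro u hu
        have := hcon u (Finset.mem_of_mem_erase hu)
        have := dg_erase G X x u
        omega
    have hBd : ¬ Dgen G b Aᶜ := fun h => hcase ⟨A, hAd, h⟩
    unfold Dgen at hBd
    push Not at hBd
    obtain ⟨B, hB, hBn, hBb⟩ := hBd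
    exact ⟨A, B, hA.1, hBn, (disjoint_compl_right (a := A)).mono_right hB, hA.2,
      fun v hv => (hBb v hv).le⟩

end StiebitzAux

open StiebitzAux in
/-- Stiebitz's theorem. -/
theorem stiebitz {V : Type*} [Fintype V] [DecidableEq V] [Nonempty V]
    (G : SimpleGraph V) [DecidableRel G.Adj] (a b : V → ℕ)
    (hdeg : ∀ u : V, a u + b u + 1 ≤ G.degree u) :
    ∃ A B : Finset V, A.Nonempty ∧ B.Nonempty ∧ Disjoint A B ∧ A ∪ B = Finset.univ ∧
      (∀ u ∈ A, a u ≤ (A.filter (G.Adj u)).card) ∧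
      (∀ v ∈ B, b v ≤ (B.filter (G.Adj v)).card) := by
  classical
  obtain ⟨A0, B, hA0, hB, hd, ha0, hb⟩ := exists_pair G a b hdeg
  obtain ⟨A, hA, hmax⟩ := Finset.exists_max_image
    (Finset.univ.filter fun A : Finset V => A.Nonempty ∧ Disjoint A B ∧ ∀ u ∈ A, a u ≤ dg G A u)
    Finset.card ⟨A0, by simpa using ⟨hA0, hd, ha0⟩⟩
  simp only [Finset.mem_filter, Finset.mem_univ, true_and] at hA hmax
  obtain ⟨hAn, hAB, ha⟩ := hA
  have hBA : B ⊆ Aᶜ := by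
    intro z hz
    simpa using Finset.disjoint_right.1 hAB hz
  refine ⟨A, Aᶜ, hAn, hB.mono hBA, disjoint_compl_right, Finset.union_compl A, ha, ?_⟩
  intro v hv
  change b v ≤ dg G Aᶜ v
  by_contra! hlt
  have hvA : v ∉ A := by simpa using hv
  by_cases hvB : v ∈ B
  · have := hb v hvB
    have := dg_mono G hBA v
    omega
  · have h1 := hmax (insert v A) ⟨Finset.insert_nonempty _ _, ?_, ?_⟩
    · rw [Finset.card_insert_of_notMem hvA] at h1
      omega
    · rw [Finset.disjoint_insert_left]
      exact ⟨hvB, hAB⟩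
    · intro u hu
      have h2 := dg_mono G (Finset.subset_insert v A) u
      rcases Finset.mem_insert.1 hu with rfl | hu
      · have := dg_compl G A u
        have := hdeg u
        omega
      · have := ha u hu
        omega
end

section
/- Kaneko's theorem: Let G be a finite simple triangle-free graph and s, t ≥ 1 integers with minimum degree δ(G) ≥ s + t. Then V(G) can be partitioned into non-empty sets S and T such that the induced subgraph G[S] has minimum degree at least s and G[T] has minimum degree at least t. -/
namespace KanekoAux

/-- Number of neighbours of `v` in `A`. -/
def dg {V : Type*} (G : SimpleGraph V) [DecidableRel G.Adj] (A : Finset V) (v : V) : ℕ :=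
  (A.filter (G.Adj v)).card

variable {V : Type*} [Fintype V] [DecidableEq V] (G : SimpleGraph V) [DecidableRel G.Adj]

/-- Nonempty with all inner degrees at least `k`. -/
def Nice (k : ℕ) (A : Finset V) : Prop := A.Nonempty ∧ ∀ u ∈ A, k ≤ dg G A u

lemma dg_mono {A B : Finset V} (h : A ⊆ B) (v : V) : dg G A v ≤ dg G B v :=
  Finset.card_le_card (Finset.filter_subset_filter _ h)

lemma dg_insert {A : Finset V} {y : V} (hy : y ∉ A) (v : V) :
    dg G (insert y A) v = dg G A v + if G.Adj v y then 1 else 0 := by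
  unfold dg
  rw [Finset.filter_insert]
  split_ifs with h
  · rw [Finset.card_insert_of_notMem (by simp [hy])]
  · rfl

lemma dg_erase {A : Finset V} {y : V} (hy : y ∈ A) (v : V) :
    dg G A v = dg G (A.erase y) v + if G.Adj v y then 1 else 0 := by
  rw [← dg_insert G (Finset.notMem_erase y A), Finset.insert_erase hy]

lemma dg_compl (A : Finset V) (v : V) : dg G A v + dg G Aᶜ v = G.degree v := by
  unfold dg
  rw [← G.card_neighborFinset_eq_degree, G.neighborFinset_eq_filter,
    ← Finset.card_union_of_disjoint, ← Finset.filter_union, Finset.union_compl]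
  exact Finset.disjoint_filter_filter disjoint_compl_right

/-- Number of edges leaving `A`. -/
def cut (A : Finset V) : ℕ := ∑ u ∈ A, dg G Aᶜ u

lemma cut_insert {A : Finset V} {y : V} (hy : y ∉ A) :
    cut G (insert y A) + dg G A y = cut G A + dg G Aᶜ y := by
  have h1 : ∀ v, dg G Aᶜ v = dg G (insert y A)ᶜ v + if G.Adj v y then 1 else 0 := by
    intro v
    rw [dg_erase G (A := Aᶜ) (y := y) (by simpa using hy) v, Finset.compl_insert]
  have h2 : dg G A y = ∑ u ∈ A, if G.Adj u y then 1 else 0 := by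
    unfold dg
    rw [Finset.card_filter]
    simp only [G.adj_comm y]
  unfold cut
  rw [Finset.sum_insert hy, h1 y, Finset.sum_congr rfl (fun u _ => h1 u),
    Finset.sum_add_distrib, ← h2]
  simp
  ring

lemma cut_erase {A : Finset V} {x : V} (hx : x ∈ A) :
    cut G (A.erase x) + dg G Aᶜ x = cut G A + dg G A x := by
  have h := cut_insert G (Finset.notMem_erase x A)
  have h1 := dg_compl G A x
  have h2 := dg_compl G (A.erase x) x
  have h3 := dg_erase G hx x
  rw [Finset.insert_erase hx] at h
  simp at h3
  omega

lemma nonnice {k : ℕ} {A : Finset V} (hA : A.Nonempty) (h : ∀ A' ⊆ A, ¬ Nice G k A') :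
    ∃ x ∈ A, dg G A x < k := by
  by_contra! hc
  exact h A subset_rfl ⟨hA, hc⟩

lemma nice_erase {k : ℕ} {A : Finset V} (hA : Nice G (k+1) A) {y : V} (hy : y ∈ A) :
    Nice G k (A.erase y) := by
  obtain ⟨_, h⟩ := hA
  constructor
  · have h1 := h y hy
    rw [dg_erase G hy] at h1
    simp only [SimpleGraph.irrefl, if_false] at h1
    have : 0 < dg G (A.erase y) y := by omega
    exact (Finset.card_pos.1 this).mono (Finset.filter_subset _ _)
  · intro u hu
    have h1 := h u (Finset.mem_of_mem_erase hu)
    rw [dg_erase G hy] at h1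
    split_ifs at h1 <;> omega

lemma exists_pair [Nonempty V] (hfree : G.CliqueFree 3) (s t : ℕ) (hs : 1 ≤ s) (ht : 1 ≤ t)
    (hmin : ∀ v, s + t ≤ G.degree v) :
    ∃ S T : Finset V, Disjoint S T ∧ Nice G s S ∧ Nice G t T := by
  by_contra! hno
  have huniv : ∀ v, dg G Finset.univ v = G.degree v := by
    intro v
    have := dg_compl G Finset.univ v
    simpa [dg] using this
  let P : Finset V → Prop := fun A =>
    (∀ A' ⊆ A, ¬ Nice G (s+1) A') ∧ (∀ B' ⊆ Aᶜ, ¬ Nice G t B')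
  have hex : ∃ A, P A := by
    obtain ⟨A, hA, hAm⟩ := Set.Finite.exists_minimal (s := {A : Finset V | Nice G s A})
      (Set.toFinite _) ⟨Finset.univ, Finset.univ_nonempty, fun u _ => by
        rw [huniv]; have := hmin u; omega⟩
    refine ⟨A, ?_, ?_⟩
    · intro A' hA' hn
      obtain ⟨y, hy⟩ := hn.1
      have := hAm (nice_erase G hn hy) ((Finset.erase_subset _ _).trans hA')
      exact Finset.notMem_erase y A' (this (hA' hy))
    · intro B' hB' hn
      exact hno A B' (Finset.disjoint_left.2 fun a ha hb => by
        have := hB' hb; simp at this; exact this ha) hA hn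
  let f : Finset V → ℤ := fun A => cut G A + ((s:ℤ) + 1 - t) * A.card
  obtain ⟨A, hPA, hAm⟩ := Set.exists_min_image {A | P A} f (Set.toFinite _) hex
  obtain ⟨hA, hB⟩ := hPA
  have hBne : (Aᶜ).Nonempty := by
    rw [Finset.nonempty_iff_ne_empty]
    intro h
    rw [Finset.compl_eq_empty_iff] at h
    subst h
    exact hA _ subset_rfl ⟨Finset.univ_nonempty, fun u _ => by
        rw [huniv]; have := hmin u; omega⟩
  obtain ⟨y, hyB, hy⟩ := nonnice G hBne hB
  have hyA : y ∉ A := by simpa using hyB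
  have hy' : ∃ A' ⊆ insert y A, Nice G (s+1) A' := by
    by_contra! hc
    have hm := hAm (insert y A) ⟨hc, fun B' hB' => hB B' (hB'.trans (by
      rw [Finset.compl_insert]; exact Finset.erase_subset _ _))⟩
    have h1 := cut_insert G hyA
    have h2 := dg_compl G A y
    have h3 := hmin y
    simp only [f, Finset.card_insert_of_notMem hyA] at hm
    push_cast at hm
    have : (cut G A : ℤ) ≤ cut G (insert y A) + (s + 1 - t) := by linarith
    omega
  obtain ⟨A', hA', hn⟩ := hy'
  have hyA' : y ∈ A' := by
    by_contra h
    exact hA A' ((Finset.subset_insert_iff_of_notMem h).1 hA') hn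
  have hn1 := nice_erase G hn hyA'
  have hsub : A'.erase y ⊆ A := Finset.subset_insert_iff.1 hA'
  obtain ⟨x, hxA, hx⟩ := nonnice G (hn1.1.mono hsub) hA
  have hx' : ∃ B' ⊆ insert x Aᶜ, Nice G t B' := by
    by_contra! hc
    have hm := hAm (A.erase x) ⟨fun A' hA' => hA A' (hA'.trans (Finset.erase_subset _ _)),
      fun B' hB' => hc B' (by rwa [Finset.compl_erase] at hB')⟩
    have h1 := cut_erase G hxA
    have h2 := dg_compl G A x
    have h3 := hmin x
    have h4 := Finset.card_erase_add_one hxA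
    simp only [f, ← h4] at hm
    push_cast at hm
    have : (cut G A : ℤ) + (s + 1 - t) ≤ cut G (A.erase x) := by linarith
    omega
  obtain ⟨B', hB', hnB⟩ := hx'
  have hdis : ∀ C ⊆ A, x ∉ C → Disjoint C B' := by
    intro C hC hxC
    refine Finset.disjoint_left.2 fun a ha hb => ?_
    have h1 := hB' hb
    rw [Finset.mem_insert, Finset.mem_compl] at h1
    rcases h1 with rfl | h1
    · exact hxC ha
    · exact h1 (hC ha)
  by_cases hxA' : x ∈ A'
  · have hxy : x ≠ y := fun h => hyA (h ▸ hxA)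
    have hxe : x ∈ A'.erase y := Finset.mem_erase.2 ⟨hxy, hxA'⟩
    have hadj : G.Adj x y := by
      by_contra hna
      have h1 := hn.2 x hxA'
      have h2 := dg_mono G hA' x
      rw [dg_insert G hyA, if_neg hna] at h2
      omega
    refine hno ((A'.erase y).erase x) B'
      (hdis _ ((Finset.erase_subset _ _).trans hsub) (Finset.notMem_erase _ _)) ⟨?_, ?_⟩ hnB
    · have h1 := hn1.2 x hxe
      rw [dg_erase G hxe] at h1
      simp only [SimpleGraph.irrefl, if_false] at h1
      have : 0 < dg G ((A'.erase y).erase x) x := by omega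
      exact (Finset.card_pos.1 this).mono (Finset.filter_subset _ _)
    · intro u hu
      have h0 := hn.2 u (Finset.mem_of_mem_erase (Finset.mem_of_mem_erase hu))
      rw [dg_erase G hyA', dg_erase G hxe] at h0
      have h3 : ¬ (G.Adj u y ∧ G.Adj u x) := by
        rintro ⟨h1, h2⟩
        exact hfree {u, x, y} (SimpleGraph.is3Clique_triple_iff.2 ⟨h2, h1, hadj⟩)
      split_ifs at h0 <;> first | omega | (exfalso; tauto)
  · exact hno _ B' (hdis _ hsub (fun h => hxA' (Finset.mem_of_mem_erase h))) hn1 hnB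

lemma extend (s t : ℕ) (hmin : ∀ v, s + t ≤ G.degree v)
    (h : ∃ S T : Finset V, Disjoint S T ∧ Nice G s S ∧ Nice G t T) :
    ∃ S T : Finset V, Disjoint S T ∧ S ∪ T = Finset.univ ∧ Nice G s S ∧ Nice G t T := by
  obtain ⟨S0, T, hd0, hS0, hT⟩ := h
  obtain ⟨S, ⟨hd, hS⟩, hm⟩ := Set.Finite.exists_maximal
    (s := {S : Finset V | Disjoint S T ∧ Nice G s S}) (Set.toFinite _) ⟨S0, hd0, hS0⟩
  have hTS : T ⊆ Sᶜ := fun a ha => Finset.mem_compl.2 (Finset.disjoint_right.1 hd ha)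
  refine ⟨S, Sᶜ, disjoint_compl_right, Finset.union_compl _, hS, hT.1.mono hTS, ?_⟩
  intro x hx
  by_cases hxT : x ∈ T
  · exact (hT.2 x hxT).trans (dg_mono G hTS x)
  by_contra! hlt
  have hxS : x ∉ S := Finset.mem_compl.1 hx
  have h1 := dg_compl G S x
  have h2 := hmin x
  have := hm (y := insert x S) ⟨Finset.disjoint_insert_left.2 ⟨hxT, hd⟩,
    Finset.insert_nonempty _ _, by
      intro u hu
      rcases Finset.mem_insert.1 hu with rfl | hu
      · exact le_trans (by omega) (dg_mono G (Finset.subset_insert u S) u)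
      · exact (hS.2 u hu).trans (dg_mono G (Finset.subset_insert x S) u)⟩
    (Finset.subset_insert x S)
  exact hxS (this (Finset.mem_insert_self x S))

end KanekoAux

/-- Kaneko's theorem for triangle-free graphs. -/
theorem kaneko {V : Type*} [Fintype V] [DecidableEq V]
    (G : SimpleGraph V) [DecidableRel G.Adj]
    (hfree : G.CliqueFree 3) (s t : ℕ) (hs : 1 ≤ s) (ht : 1 ≤ t)
    (hmin : s + t ≤ G.minDegree) :
    ∃ S T : Finset V, S.Nonempty ∧ T.Nonempty ∧ Disjoint S T ∧ S ∪ T = Finset.univ ∧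
      (∀ u ∈ S, s ≤ (S.filter (G.Adj u)).card) ∧
      (∀ v ∈ T, t ≤ (T.filter (G.Adj v)).card) := by
  have hne : Nonempty V := by
    by_contra h
    rw [not_nonempty_iff] at h
    have : G.minDegree = 0 := by simp
    omega
  have hd : ∀ v, s + t ≤ G.degree v := fun v => hmin.trans (G.minDegree_le_degree v)
  obtain ⟨S, T, h1, h2, h3, h4⟩ := KanekoAux.extend G s t hd
    (KanekoAux.exists_pair G hfree s t hs ht hd)
  exact ⟨S, T, h3.1, h4.1, h1, h2, h3.2, h4.2⟩
end

section
/- Main theorem, part (ii): Let G be a finite simple graph with at least five vertices, let T_1 be the set of vertices of G contained in at least one subgraph of G isomorphic to K_{2,3}, and T_0 = V(G) \ T_1. For h(u) = 1 if u ∈ T_1 and h(u) = 0 otherwise, suppose a, b : V(G) → ℤ≥0 satisfy d_G(u) ≥ a(u) + b(u) + h(u) and min{a(u), b(u)} ≥ 2 − h(u) for every vertex u. Then V(G) admits a partition (A, B) into non-empty sets with d_A(u) ≥ a(u) for all u ∈ A and d_B(v) ≥ b(v) for all v ∈ B. -/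
/-- `u` lies in a (not necessarily induced) subgraph of `G` isomorphic to `H`. -/
def MemCopy {W V : Type*} (H : SimpleGraph W) (G : SimpleGraph V) (u : V) : Prop :=
  ∃ f : W → V, Function.Injective f ∧ (∀ ⦃x y : W⦄, H.Adj x y → G.Adj (f x) (f y)) ∧
    u ∈ Set.range f

set_option linter.unusedSectionVars false

namespace KP

variable {V : Type*} [Fintype V] [DecidableEq V]

/-- number of neighbours of `u` in `S` -/
def dg (G : SimpleGraph V) [DecidableRel G.Adj] (S : Finset V) (u : V) : ℕ :=
  (S.filter (G.Adj u)).card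

/-- adjacency indicator -/
def ad (G : SimpleGraph V) [DecidableRel G.Adj] (u v : V) : ℕ := if G.Adj u v then 1 else 0

variable (G : SimpleGraph V) [DecidableRel G.Adj]

lemma ad_le (u v : V) : ad G u v ≤ 1 := by unfold ad; split_ifs <;> simp

lemma ad_comm (u v : V) : ad G u v = ad G v u := by simp [ad, G.adj_comm]

lemma ad_self (u : V) : ad G u u = 0 := by simp [ad]

lemma ad_eq_one {u v : V} : ad G u v = 1 ↔ G.Adj u v := by
  unfold ad; split_ifs with h <;> simp [h]

lemma dg_mono {S T : Finset V} (h : S ⊆ T) (u : V) : dg G S u ≤ dg G T u :=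
  Finset.card_le_card (Finset.filter_subset_filter _ h)

lemma dg_insert {S : Finset V} {v : V} (h : v ∉ S) (u : V) :
    dg G (insert v S) u = dg G S u + ad G u v := by
  unfold dg ad
  rw [Finset.filter_insert]
  split_ifs with h1
  · rw [Finset.card_insert_of_notMem (by simp [h])]
  · simp

lemma dg_insert_le (S : Finset V) (v u : V) : dg G (insert v S) u ≤ dg G S u + ad G u v := by
  by_cases h : v ∈ S
  · simp [h]
  · exact (dg_insert G h u).le

lemma dg_erase {S : Finset V} {v : V} (h : v ∈ S) (u : V) :
    dg G (S.erase v) u + ad G u v = dg G S u := by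
  rw [← dg_insert G (Finset.notMem_erase v S), Finset.insert_erase h]

lemma dg_le_erase (S : Finset V) (v u : V) : dg G S u ≤ dg G (S.erase v) u + ad G u v := by
  by_cases h : v ∈ S
  · exact (dg_erase G h u).ge
  · simp [h]

lemma dg_compl (S : Finset V) (u : V) : dg G S u + dg G Sᶜ u = G.degree u := by
  unfold dg
  rw [← Finset.card_union_of_disjoint
    (Finset.disjoint_filter_filter disjoint_compl_right), ← Finset.filter_union,
    Finset.union_compl, ← G.card_neighborFinset_eq_degree]
  congr 1; ext; simp

lemma dg_pos_nonempty {S : Finset V} {u : V} (h : 0 < dg G S u) : S.Nonempty := by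
  obtain ⟨x, hx⟩ := Finset.card_pos.mp h
  exact ⟨x, (Finset.mem_filter.mp hx).1⟩

/-- if the degree does not drop, neighbours are kept -/
lemma mem_of_dg {S T : Finset V} {u v : V} (hS : S ⊆ T) (h : dg G T u ≤ dg G S u)
    (hv : v ∈ T) (huv : G.Adj u v) : v ∈ S := by
  have := Finset.eq_of_subset_of_card_le (Finset.filter_subset_filter (G.Adj u) hS) h
  have h2 : v ∈ T.filter (G.Adj u) := by simp [hv, huv]
  rw [← this] at h2
  exact (Finset.mem_filter.mp h2).1

/-- feasibility -/
def feas (f : V → ℕ) (S : Finset V) : Prop := ∀ u ∈ S, f u ≤ dg G S u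

lemma feas_erase {f : V → ℕ} {S : Finset V} (h : feas G (fun u => f u + 1) S) (v : V) :
    feas G f (S.erase v) := by
  intro u hu
  have h1 := h u (Finset.mem_of_mem_erase hu)
  have h2 := dg_le_erase G S v u
  have := ad_le G u v
  simp only at h1
  omega

lemma erase_nonempty {f : V → ℕ} {S : Finset V} (h : feas G (fun u => f u + 1) S)
    (hS : S.Nonempty) (v : V) : (S.erase v).Nonempty := by
  by_cases hv : v ∈ S
  · have h1 := h v hv
    have h2 := dg_le_erase G S v v
    rw [ad_self] at h2
    simp only at h1
    exact dg_pos_nonempty G (u := v) (by omega)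
  · rwa [Finset.erase_eq_of_notMem hv]

/-- no subset is feasible -/
def none (f : V → ℕ) (S : Finset V) : Prop := ∀ T ⊆ S, T.Nonempty → ¬ feas G f T

lemma none_mono {f : V → ℕ} {S T : Finset V} (h : none G f T) (hS : S ⊆ T) : none G f S :=
  fun U hU => h U (hU.trans hS)

lemma none_low {f : V → ℕ} {S : Finset V} (h : none G f S) (hS : S.Nonempty) :
    ∃ u ∈ S, dg G S u < f u := by
  by_contra! hc
  exact h S subset_rfl hS hc

/-- hypotheses -/
structure Hyp (a b h : V → ℕ) : Prop where
  h1 : ∀ u, h u ≤ 1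
  ha : ∀ u, 2 ≤ a u + h u
  hb : ∀ u, 2 ≤ b u + h u
  deg : ∀ u, a u + b u + h u ≤ G.degree u
  K : ∀ p q r s t, p ≠ q → r ≠ s → r ≠ t → s ≠ t → G.Adj p r → G.Adj p s → G.Adj p t →
    G.Adj q r → G.Adj q s → G.Adj q t → h p = 1
  NF : ∀ S T : Finset V, S.Nonempty → T.Nonempty → Disjoint S T → feas G a S → feas G b T → False
  ne : Nonempty V

def S2 (F : Finset V) : ℤ := ∑ u ∈ F, (dg G F u : ℤ)

lemma S2_insert {F : Finset V} {y : V} (hy : y ∉ F) :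
    S2 G (insert y F) = S2 G F + 2 * dg G F y := by
  unfold S2
  rw [Finset.sum_insert hy]
  have h1 : ∑ u ∈ F, (dg G (insert y F) u : ℤ) = ∑ u ∈ F, ((dg G F u : ℤ) + ad G u y) := by
    refine Finset.sum_congr rfl fun u _ => ?_
    rw [dg_insert G hy]; push_cast; rfl
  have h2 : ∑ u ∈ F, (ad G u y : ℤ) = dg G F y := by
    unfold ad dg
    rw [Finset.card_filter]
    push_cast
    refine Finset.sum_congr rfl fun u _ => ?_
    simp [G.adj_comm]
  rw [h1, Finset.sum_add_distrib, h2, dg_insert G hy, ad_self]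
  push_cast; ring

/-- weight -/
def W (a b : V → ℕ) (F : Finset V) : ℤ :=
  S2 G F + S2 G Fᶜ + 2 * (∑ u ∈ F, (a u : ℤ)) + 2 * (∑ u ∈ Fᶜ, (b u : ℤ))

lemma W_insert (a b : V → ℕ) {F : Finset V} {y : V} (hy : y ∉ F) :
    W G a b (insert y F) = W G a b F + 2 * (dg G F y - dg G Fᶜ y + a y - b y) := by
  have hc : Fᶜ = insert y (insert y F)ᶜ := by
    ext x; simp only [Finset.mem_insert, Finset.mem_compl]; by_cases x = y <;> simp_all
  have hn : y ∉ (insert y F)ᶜ := by simp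
  unfold W
  rw [S2_insert G hy, Finset.sum_insert hy]
  rw [hc, S2_insert G hn, Finset.sum_insert hn, dg_insert G hn, ad_self]
  push_cast; ring

/-- admissible sets -/
def P (a b h : V → ℕ) (F : Finset V) : Prop :=
  none G (fun u => b u + 1) F ∧ none G (fun u => a u + h u) Fᶜ

/-- optimal admissible sets -/
def Opt (a b h : V → ℕ) (F : Finset V) : Prop :=
  P G a b h F ∧ (∀ F', P G a b h F' → W G a b F' ≤ W G a b F) ∧
    (∀ F', P G a b h F' → W G a b F' = W G a b F → F.card ≤ F'.card)

variable {G} {a b h : V → ℕ}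

lemma exists_P (H : Hyp G a b h) : ∃ F, P G a b h F := by
  classical
  have hV : (Finset.univ : Finset V).Nonempty := @Finset.univ_nonempty V _ H.ne
  have hd : ∀ u, dg G Finset.univ u = G.degree u := by
    intro u
    have := dg_compl G Finset.univ u
    simpa [dg] using this
  have hfV : feas G b Finset.univ := by
    intro u _
    have := H.deg u
    rw [hd]; omega
  obtain ⟨F, hF, hmin⟩ := Finset.exists_min_image
    (Finset.univ.filter fun F : Finset V => F.Nonempty ∧ feas G b F) Finset.card
    ⟨Finset.univ, by simp [hV, hfV]⟩
  simp only [Finset.mem_filter, Finset.mem_univ, true_and] at hF hmin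
  refine ⟨F, ?_, ?_⟩
  · intro T hT hTn hf
    obtain ⟨v, hv⟩ := hTn
    have h1 := hmin (T.erase v) ⟨erase_nonempty G hf ⟨v, hv⟩ v, feas_erase G hf v⟩
    have h2 := Finset.card_erase_lt_of_mem hv
    have h3 := Finset.card_le_card hT
    omega
  · intro T hT hTn hf
    refine H.NF T F hTn hF.1 ?_ ?_ hF.2
    · exact Finset.disjoint_left.mpr fun x hx => Finset.mem_compl.mp (hT hx)
    · intro u hu
      have := hf u hu
      simp only at this; omega

lemma exists_Opt (H : Hyp G a b h) : ∃ F, Opt G a b h F := by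
  classical
  obtain ⟨F0, h0⟩ := exists_P H
  obtain ⟨F1, h1, m1⟩ := Finset.exists_max_image
    (Finset.univ.filter fun F : Finset V => P G a b h F) (W G a b) ⟨F0, by simp [h0]⟩
  simp only [Finset.mem_filter, Finset.mem_univ, true_and] at h1 m1
  obtain ⟨F, h2, m2⟩ := Finset.exists_min_image
    (Finset.univ.filter fun F : Finset V => P G a b h F ∧ W G a b F = W G a b F1)
    Finset.card ⟨F1, by simp [h1]⟩
  simp only [Finset.mem_filter, Finset.mem_univ, true_and] at h2 m2
  refine ⟨F, h2.1, fun F' hF' => h2.2 ▸ m1 F' hF', fun F' hF' hw => m2 F' ⟨hF', ?_⟩⟩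
  rw [hw, h2.2]

lemma compl_insert' (F : Finset V) (y : V) : (insert y F)ᶜ = Fᶜ.erase y := by
  ext x; simp [Finset.mem_compl]

lemma compl_erase' (F : Finset V) (z : V) : (F.erase z)ᶜ = insert z Fᶜ := by
  ext x; simp only [Finset.mem_insert, Finset.mem_compl, Finset.mem_erase]; tauto

lemma compl_swap {F : Finset V} {y z : V} (hz : z ∈ F) (hy : y ∉ F) :
    (insert y (F.erase z))ᶜ = insert z (Fᶜ.erase y) := by
  ext x; simp only [Finset.mem_insert, Finset.mem_compl, Finset.mem_erase]
  by_cases hx : x = z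
  · subst hx
    have : x ≠ y := fun h => hy (h ▸ hz)
    simp [this]
  · simp [hx]

lemma W_erase (a b : V → ℕ) {F : Finset V} {z : V} (hz : z ∈ F) :
    W G a b (F.erase z) = W G a b F - 2 * (dg G F z - dg G Fᶜ z + a z - b z) := by
  have h1 := W_insert G a b (Finset.notMem_erase z F)
  rw [Finset.insert_erase hz, compl_erase', dg_insert G (by simpa using hz), ad_self] at h1
  have h2 := dg_erase G hz z
  rw [ad_self] at h2
  rw [h1, ← h2]; push_cast; ring

/-- basic structure of an optimal set -/
structure Str (G : SimpleGraph V) [DecidableRel G.Adj] (a b h : V → ℕ) (F : Finset V) : Prop where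
  Yne : ∃ y ∈ Fᶜ, dg G Fᶜ y < a y + h y
  Lne : ∃ z ∈ F, dg G F z < b z + 1
  adj : ∀ y ∈ Fᶜ, ∀ z ∈ F, dg G Fᶜ y < a y + h y → dg G F z < b z + 1 → G.Adj y z
  dY : ∀ y ∈ Fᶜ, dg G Fᶜ y < a y + h y → dg G Fᶜ y + 1 = a y + h y ∧ b y + 1 ≤ dg G F y
  dL : ∀ z ∈ F, dg G F z < b z + 1 → dg G F z = b z ∧ a z + h z ≤ dg G Fᶜ z
  full : ∀ y ∈ Fᶜ, dg G Fᶜ y < a y + h y → feas G (fun u => b u + 1) (insert y F)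
  bad : ∀ z ∈ F, dg G F z < b z + 1 → none G b (F.erase z)

lemma Opt.str (H : Hyp G a b h) {F : Finset V} (O : Opt G a b h F) : Str G a b h F := by
  obtain ⟨⟨hD, hM⟩, hW, hc⟩ := O
  have hV : (Finset.univ : Finset V).Nonempty := @Finset.univ_nonempty V _ H.ne
  have hd : ∀ u, dg G Finset.univ u = G.degree u := by
    intro u
    have := dg_compl G Finset.univ u
    simpa [dg] using this
  have hFne : F.Nonempty := by
    rw [Finset.nonempty_iff_ne_empty]
    rintro rfl
    refine hM Finset.univ (by simp) hV ?_
    intro u _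
    have := H.deg u
    rw [hd]; simp only; omega
  have hCne : Fᶜ.Nonempty := by
    rw [Finset.nonempty_iff_ne_empty]
    intro hE
    have : F = Finset.univ := by simpa using hE
    subst this
    refine hD Finset.univ (by simp) hV ?_
    intro u _
    have := H.deg u
    have := H.ha u
    have := H.h1 u
    rw [hd]; simp only; omega
  -- moving y
  have hY : ∀ y ∈ Fᶜ, dg G Fᶜ y < a y + h y → b y + 1 ≤ dg G F y ∧
      ∃ T ⊆ insert y F, T.Nonempty ∧ feas G (fun u => b u + 1) T := by
    intro y hy hl
    have hyF : y ∉ F := by simpa using hy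
    have h1 := dg_compl G F y
    have h2 := H.deg y
    have h3 := H.h1 y
    refine ⟨by omega, ?_⟩
    by_contra! hcon
    have hP : P G a b h (insert y F) := by
      refine ⟨fun T hT hn hf => hcon T hT hn hf, none_mono G hM ?_⟩
      rw [compl_insert']; exact Finset.erase_subset _ _
    have h4 := hW _ hP
    rw [W_insert G a b hyF] at h4
    omega
  have hL : ∀ z ∈ F, dg G F z < b z + 1 → a z + h z ≤ dg G Fᶜ z ∧
      ∃ T ⊆ insert z Fᶜ, T.Nonempty ∧ feas G (fun u => a u + h u) T := by
    intro z hz hl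
    have h1 := dg_compl G F z
    have h2 := H.deg z
    refine ⟨by omega, ?_⟩
    by_contra! hcon
    have hP : P G a b h (F.erase z) := by
      refine ⟨none_mono G hD (Finset.erase_subset _ _), ?_⟩
      rw [compl_erase']
      exact fun T hT hn hf => hcon T hT hn hf
    have h4 := hW _ hP
    have h5 := hc _ hP
    rw [W_erase a b hz] at h4 h5
    have h6 := Finset.card_erase_lt_of_mem hz
    have := h5 (by omega)
    omega
  have hfa : ∀ T, feas G (fun u => a u + h u) T → feas G a T := by
    intro T hT u hu
    have := hT u hu
    simp only at this; omega
  have hbad : ∀ z ∈ F, dg G F z < b z + 1 → none G b (F.erase z) := by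
    intro z hz hl T hT hTn hf
    obtain ⟨-, A, hA, hAn, hAf⟩ := hL z hz hl
    refine H.NF A T hAn hTn ?_ (hfa A hAf) hf
    rw [Finset.disjoint_left]
    intro x hx hx2
    have h1 := hA hx
    have h2 := hT hx2
    simp at h1 h2
    tauto
  have key : ∀ y ∈ Fᶜ, ∀ z ∈ F, dg G Fᶜ y < a y + h y → dg G F z < b z + 1 →
      G.Adj y z ∧ dg G Fᶜ y + 1 = a y + h y := by
    intro y hy z hz hly hlz
    obtain ⟨-, A, hA, hAn, hAf⟩ := hL z hz hlz
    obtain ⟨-, T, hT, hTn, hTf⟩ := hY y hy hly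
    have hyA : y ∈ A := by
      by_contra hyA
      refine H.NF A (T.erase z) hAn (erase_nonempty G hTf hTn z) ?_ (hfa A hAf)
        (feas_erase G hTf z)
      rw [Finset.disjoint_left]
      intro x hx hx2
      have h1 := hA hx
      have h2 := hT (Finset.mem_of_mem_erase hx2)
      have h3 := Finset.ne_of_mem_erase hx2
      simp at h1 h2
      rcases h2 with rfl | h2
      · exact hyA hx
      · tauto
    have h1 := hAf y hyA
    have h2 := dg_mono G hA y
    have hz' : z ∉ Fᶜ := by simpa using hz
    rw [dg_insert G hz'] at h2
    have h3 := ad_le G y z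
    simp only at h1
    exact ⟨(ad_eq_one G).mp (by omega), by omega⟩
  have keyT : ∀ y ∈ Fᶜ, ∀ z ∈ F, dg G F z < b z + 1 → ∀ T ⊆ insert y F, T.Nonempty →
      feas G (fun u => b u + 1) T → z ∈ T := by
    intro y hy z hz hlz T hT hTn hTf
    by_contra hzT
    refine hbad z hz hlz (T.erase y) ?_ (erase_nonempty G hTf hTn y) (feas_erase G hTf y)
    intro x hx
    have h1 := hT (Finset.mem_of_mem_erase hx)
    have h2 := Finset.ne_of_mem_erase hx
    simp only [Finset.mem_insert, h2, false_or] at h1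
    refine Finset.mem_erase.mpr ⟨?_, h1⟩
    rintro rfl
    exact hzT (Finset.mem_of_mem_erase hx)
  obtain ⟨y0, hy0, hly0⟩ := none_low G hM hCne
  obtain ⟨z0, hz0, hlz0⟩ := none_low G hD hFne
  refine ⟨⟨y0, hy0, hly0⟩, ⟨z0, hz0, hlz0⟩, fun y hy z hz h1 h2 => (key y hy z hz h1 h2).1,
    fun y hy h1 => ⟨(key y hy z0 hz0 h1 hlz0).2, (hY y hy h1).1⟩, ?_, ?_, hbad⟩
  · intro z hz hlz
    refine ⟨?_, (hL z hz hlz).1⟩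
    obtain ⟨-, T, hT, hTn, hTf⟩ := hY y0 hy0 hly0
    have h1 := hTf z (keyT y0 hy0 z hz hlz T hT hTn hTf)
    have h2 := dg_mono G hT z
    rw [dg_insert G (by simpa using hy0)] at h2
    have h3 := ad_le G z y0
    simp only at h1
    omega
  · intro y hy hly u hu
    obtain ⟨hyd, T, hT, hTn, hTf⟩ := hY y hy hly
    have hyF : y ∉ F := by simpa using hy
    simp only
    rcases Finset.mem_insert.mp hu with rfl | huF
    · rw [dg_insert G hyF, ad_self]; omega
    · by_contra! hcon
      have h2 : dg G F u < b u + 1 := lt_of_le_of_lt (dg_mono G (Finset.subset_insert _ _) u) hcon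
      have h1 := hTf u (keyT y hy u huF h2 T hT hTn hTf)
      have h3 := dg_mono G hT u
      simp only at h1
      omega

/-- every low vertex of `F` has a low neighbour in `F` -/
lemma Str.nbr (H : Hyp G a b h) {F : Finset V} (S : Str G a b h F) {z : V} (hz : z ∈ F)
    (hlz : dg G F z < b z + 1) : ∃ w ∈ F, dg G F w < b w + 1 ∧ G.Adj w z := by
  obtain ⟨y, hy, hly⟩ := S.Yne
  have hne : (F.erase z).Nonempty := by
    have h1 := (S.dY y hy hly).2
    have h2 := dg_le_erase G F z y
    have h3 := ad_le G y z
    have h4 := H.hb y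
    have h5 := H.h1 y
    exact dg_pos_nonempty G (u := y) (by omega)
  obtain ⟨w, hw, hlw⟩ := none_low G (S.bad z hz hlz) hne
  have hwF := Finset.mem_of_mem_erase hw
  have h1 := dg_erase G hz w
  have h2 := ad_le G w z
  have h3 : dg G F w < b w + 1 := by omega
  have h4 := (S.dL w hwF h3).1
  exact ⟨w, hwF, h3, (ad_eq_one G).mp (by omega)⟩

lemma dg_swapF {F : Finset V} {y z : V} (hz : z ∈ F) (hy : y ∉ F) (u : V) :
    dg G (insert y (F.erase z)) u + ad G u z = dg G F u + ad G u y := by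
  have h1 : y ∉ F.erase z := fun h => hy (Finset.mem_of_mem_erase h)
  have := dg_erase G hz u
  rw [dg_insert G h1]; omega

lemma dg_swapC {F : Finset V} {y z : V} (hz : z ∈ F) (hy : y ∉ F) (u : V) :
    dg G (insert y (F.erase z))ᶜ u + ad G u y = dg G Fᶜ u + ad G u z := by
  have h1 := dg_swapF (G := G) hz hy u
  have h2 := dg_compl G F u
  have h3 := dg_compl G (insert y (F.erase z)) u
  omega

lemma Opt.swap (H : Hyp G a b h) {F : Finset V} (O : Opt G a b h F) {y z : V} (hy : y ∈ Fᶜ)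
    (hz : z ∈ F) (hly : dg G Fᶜ y < a y + h y) (hlz : dg G F z < b z + 1) :
    P G a b h (insert y (F.erase z)) ∧ none G a (insert y (F.erase z))ᶜ ∧
    dg G F y + dg G Fᶜ z ≤ b y + 1 + a z + h y ∧
    (dg G F y + dg G Fᶜ z = b y + 1 + a z + h y → Opt G a b h (insert y (F.erase z))) := by
  have S := O.str H
  have hyF : y ∉ F := by simpa using hy
  have hyz : y ≠ z := fun h => hyF (h ▸ hz)
  have hfull := S.full y hy hly
  have heq : insert y (F.erase z) = (insert y F).erase z :=
    (Finset.erase_insert_of_ne hyz).symm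
  have hfe := feas_erase G hfull z
  have hnone : none G a (insert y (F.erase z))ᶜ := by
    intro T hT hTn hf
    refine H.NF T (insert y (F.erase z)) hTn ⟨y, by simp⟩ ?_ hf (heq ▸ hfe)
    exact Finset.disjoint_left.mpr fun x hx => Finset.mem_compl.mp (hT hx)
  have hP : P G a b h (insert y (F.erase z)) := by
    constructor
    · intro T hT hTn hf
      refine S.bad z hz hlz (T.erase y) ?_ (erase_nonempty G hf hTn y) (feas_erase G hf y)
      intro x hx
      have h1 := hT (Finset.mem_of_mem_erase hx)
      have h2 := Finset.ne_of_mem_erase hx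
      simpa [h2] using h1
    · intro T hT hTn hf
      refine hnone T hT hTn fun u hu => ?_
      have := hf u hu
      simp only at this; omega
  have hw : W G a b (insert y (F.erase z)) = W G a b F +
      2 * ((dg G F y + dg G Fᶜ z : ℤ) - (b y + 1 + a z + h y)) := by
    have h1 : y ∉ F.erase z := fun h => hyF (Finset.mem_of_mem_erase h)
    have h2 := dg_erase G hz y
    have h3 : ad G y z = 1 := (ad_eq_one G).mpr (S.adj y hy z hz hly hlz)
    have h4 := (S.dY y hy hly).1
    have h5 := (S.dL z hz hlz).1
    rw [W_insert G a b h1, W_erase a b hz, compl_erase', dg_insert G (by simpa using hz)]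
    push_cast
    omega
  have hle := O.2.1 _ hP
  refine ⟨hP, hnone, by omega, fun he => ⟨hP, fun F' hF' => ?_, fun F' hF' hw' => ?_⟩⟩
  · have := O.2.1 F' hF'
    omega
  · have h1 := O.2.2 F' hF' (by omega)
    have h2 : (insert y (F.erase z)).card = F.card := by
      rw [Finset.card_insert_of_notMem (fun h => hyF (Finset.mem_of_mem_erase h)),
        Finset.card_erase_add_one hz]
    omega

/-- tight configuration -/
def Tight (G : SimpleGraph V) [DecidableRel G.Adj] (a b h : V → ℕ) (F : Finset V) (y : V) : Prop :=
  Opt G a b h F ∧ y ∈ Fᶜ ∧ dg G Fᶜ y < a y + h y ∧ dg G F y = b y + 1 ∧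
    ∀ z ∈ F, dg G F z < b z + 1 → h z = 0 ∧ dg G Fᶜ z = a z

lemma tight_of_zero (H : Hyp G a b h) {F : Finset V} (O : Opt G a b h F) {y : V} (hy : y ∈ Fᶜ)
    (hly : dg G Fᶜ y < a y + h y) (h0 : h y = 0) : Tight G a b h F y := by
  have S := O.str H
  have h1 := S.dY y hy hly
  obtain ⟨z0, hz0, hlz0⟩ := S.Lne
  refine ⟨O, hy, hly, ?_, ?_⟩
  · have h2 := (O.swap H hy hz0 hly hlz0).2.2.1
    have h3 := S.dL z0 hz0 hlz0
    omega
  · intro z hz hlz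
    have h2 := (O.swap H hy hz hly hlz).2.2.1
    have h3 := S.dL z hz hlz
    omega

lemma exists_tight (H : Hyp G a b h) : ∃ F y, Tight G a b h F y := by
  obtain ⟨F, O⟩ := exists_Opt H
  have S := O.str H
  obtain ⟨y, hy, hly⟩ := S.Yne
  have hyF : y ∉ F := by simpa using hy
  have hyd := S.dY y hy hly
  by_cases h0 : h y = 0
  · exact ⟨F, y, tight_of_zero H O hy hly h0⟩
  have h1 : h y = 1 := by have := H.h1 y; omega
  have hLz : ∀ z ∈ F, dg G F z < b z + 1 → dg G Fᶜ z = a z := by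
    intro z hz hlz
    obtain ⟨hP, hnone, hle, hO⟩ := O.swap H hy hz hly hlz
    have hzd := S.dL z hz hlz
    by_contra hne
    have O' := hO (by omega)
    obtain ⟨x, hx, hlx⟩ := none_low G hnone ⟨z, by rw [compl_swap hz hyF]; simp⟩
    have hyz := S.adj y hy z hz hly hlz
    have hxC := dg_swapC (G := G) hz hyF x
    have hxz : x ≠ z := by
      rintro rfl
      rw [ad_self, ad_comm, (ad_eq_one G).mpr hyz] at hxC
      omega
    have hxF : x ∈ Fᶜ := by
      rw [compl_swap hz hyF] at hx
      simp only [Finset.mem_insert, hxz, false_or] at hx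
      exact Finset.mem_of_mem_erase hx
    have hx0 : h x = 0 := by
      have := ad_le G x y
      by_cases hlow : dg G Fᶜ x < a x + h x
      · have h2 := (S.dY x hxF hlow).1
        have h3 := (ad_eq_one G).mpr (S.adj x hxF z hz hlow hlz)
        omega
      · omega
    have T := tight_of_zero H O' hx (by omega) hx0
    have h4 := dg_swapF (G := G) hz hyF y
    rw [ad_self, (ad_eq_one G).mpr hyz] at h4
    have := (T.2.2.2.2 y (by simp) (by omega)).1
    omega
  by_cases hF : dg G F y = b y + 1
  · refine ⟨F, y, O, hy, hly, hF, fun z hz hlz => ⟨?_, hLz z hz hlz⟩⟩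
    have := (S.dL z hz hlz).2
    have := hLz z hz hlz
    omega
  · obtain ⟨z, hz, hlz⟩ := S.Lne
    obtain ⟨hP, hnone, hle, hO⟩ := O.swap H hy hz hly hlz
    have h2 := hLz z hz hlz
    have h3 := (S.dL z hz hlz).2
    have O' := hO (by omega)
    have hyz := S.adj y hy z hz hly hlz
    have hzC := dg_swapC (G := G) hz hyF z
    rw [ad_self, ad_comm, (ad_eq_one G).mpr hyz] at hzC
    refine ⟨_, z, tight_of_zero H O' ?_ (by omega) (by omega)⟩
    rw [compl_swap hz hyF]; simp

/-- The key exchange: a strongly low `x` of `C - y` that is not adjacent to `z`. -/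
lemma Tight.key (H : Hyp G a b h) {F : Finset V} {y : V} (T : Tight G a b h F y) {x z : V}
    (hx : x ∈ Fᶜ.erase y) (hlx : dg G (Fᶜ.erase y) x < a x) (hz : z ∈ F)
    (hlz : dg G F z < b z + 1) (hxz : ¬ G.Adj x z) :
    G.Adj y x ∧ ∀ w ∈ F, dg G F w < b w + 1 → G.Adj w z → G.Adj w x ∧
      ∀ t ∈ F, t ≠ z → G.Adj w t → G.Adj t z → dg G F t = b t + 1 → G.Adj t y ∨ G.Adj t x := by
  obtain ⟨O, hy, hly, hyF1, hL⟩ := T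
  have S := O.str H
  have hyF : y ∉ F := by simpa using hy
  have hxy : x ≠ y := Finset.ne_of_mem_erase hx
  have hxC : x ∈ Fᶜ := Finset.mem_of_mem_erase hx
  have hxF : x ∉ F := by simpa using hxC
  have hxnz : x ≠ z := fun h => hxF (h ▸ hz)
  have hyz := S.adj y hy z hz hly hlz
  obtain ⟨hP, hnone, hle, -⟩ := O.swap H hy hz hly hlz
  set Fs := insert y (F.erase z) with hFs
  have hxFs : x ∉ Fs := by simp [hFs, hxy, hxF]
  have hz0 := hL z hz hlz
  have hzb := (S.dL z hz hlz).1
  have hyd := S.dY y hy hly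
  -- weight of Fs
  have hw : W G a b Fs = W G a b F + 2 * (- (h y : ℤ)) := by
    have h1 : y ∉ F.erase z := fun h => hyF (Finset.mem_of_mem_erase h)
    have h2 := dg_erase G hz y
    have h3 : ad G y z = 1 := (ad_eq_one G).mpr hyz
    rw [hFs, W_insert G a b h1, W_erase a b hz, compl_erase', dg_insert G (by simpa using hz)]
    push_cast
    omega
  have hadxz : ad G x z = 0 := by simp [ad, hxz]
  have hw2 : W G a b F < W G a b (insert x Fs) := by
    rw [W_insert G a b hxFs, hw]
    have h1 := dg_swapC (G := G) hz hyF x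
    have h2 := dg_compl G Fs x
    have h3 := dg_erase G hy x
    have h4 := H.deg x
    have h5 := H.h1 y
    rw [← hFs] at h1
    omega
  have hnP : ¬ P G a b h (insert x Fs) := fun hp => by
    have := O.2.1 _ hp
    omega
  have hT : ∃ T ⊆ insert x Fs, T.Nonempty ∧ feas G (fun u => b u + 1) T := by
    by_contra! hcon
    refine hnP ⟨fun T h1 h2 h3 => hcon T h1 h2 h3, none_mono G hP.2 ?_⟩
    rw [compl_insert']; exact Finset.erase_subset _ _
  obtain ⟨T, hTs, hTn, hTf⟩ := hT
  have hyT : y ∈ T := by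
    by_contra hyT
    refine S.bad z hz hlz (T.erase x) ?_ (erase_nonempty G hTf hTn x) (feas_erase G hTf x)
    intro v hv
    have h1 := hTs (Finset.mem_of_mem_erase hv)
    have h2 := Finset.ne_of_mem_erase hv
    have h3 : v ≠ y := fun h => hyT (h ▸ Finset.mem_of_mem_erase hv)
    simpa [h2, h3, hFs] using h1
  have hbound : ∀ v ∈ T, b v + 1 + ad G v z ≤ dg G F v + ad G v y + ad G v x := by
    intro v hv
    have h1 := hTf v hv
    have h2 := dg_mono G hTs v
    rw [dg_insert G hxFs] at h2
    have h3 := dg_swapF (G := G) hz hyF v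
    rw [← hFs] at h3
    simp only at h1
    omega
  have hin : ∀ v ∈ T, dg G F v + ad G v y + ad G v x ≤ b v + 1 + ad G v z →
      ∀ u ∈ F, u ≠ z → G.Adj v u → u ∈ T := by
    intro v hv hd u hu huz hvu
    refine mem_of_dg G hTs ?_ ?_ hvu
    · have h1 := hTf v hv
      rw [dg_insert G hxFs]
      have h3 := dg_swapF (G := G) hz hyF v
      rw [← hFs] at h3
      simp only at h1
      omega
    · simp [hFs, hu, huz]
  have hyb := hbound y hyT
  rw [ad_self, (ad_eq_one G).mpr hyz] at hyb
  have hyx1 := ad_le G y x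
  refine ⟨(ad_eq_one G).mp (by omega), ?_⟩
  intro w hw hlw hwz
  have hyw := S.adj y hy w hw hly hlw
  have hwT : w ∈ T := by
    refine hin y hyT ?_ w hw hwz.ne hyw
    rw [ad_self, (ad_eq_one G).mpr hyz]; omega
  have hwb := hbound w hwT
  have hwd := (S.dL w hw hlw).1
  rw [(ad_eq_one G).mpr hwz, (ad_eq_one G).mpr hyw.symm] at hwb
  have hwx1 := ad_le G w x
  refine ⟨(ad_eq_one G).mp (by omega), ?_⟩
  intro t ht htz hwt htz' htd
  have htT : t ∈ T := by
    refine hin w hwT ?_ t ht htz hwt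
    rw [(ad_eq_one G).mpr hwz, (ad_eq_one G).mpr hyw.symm]; omega
  have htb := hbound t htT
  rw [(ad_eq_one G).mpr htz'] at htb
  by_contra! hcon
  have h1 : ad G t y = 0 := by simp [ad, hcon.1]
  have h2 : ad G t x = 0 := by simp [ad, hcon.2]
  omega

lemma Hyp.false (H : Hyp G a b h) : False := by
  obtain ⟨F, y, T⟩ := exists_tight H
  obtain ⟨O, hy, hly, hyF1, hL⟩ := id T
  have S := O.str H
  have hyF : y ∉ F := by simpa using hy
  have hyd := S.dY y hy hly
  obtain ⟨z, hz, hlz⟩ := S.Lne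
  -- choice of x
  have hCn : none G a (Fᶜ.erase y) := by
    refine none_mono G (O.swap H hy hz hly hlz).2.1 ?_
    rw [compl_swap hz hyF]; exact Finset.subset_insert _ _
  have hCne : (Fᶜ.erase y).Nonempty := by
    have h1 := dg_erase G hy y
    rw [ad_self] at h1
    have := H.ha y
    exact dg_pos_nonempty G (u := y) (by omega)
  obtain ⟨x, hx, hlx⟩ := none_low G hCn hCne
  have hxy : x ≠ y := Finset.ne_of_mem_erase hx
  have hxF : x ∉ F := by simpa using Finset.mem_of_mem_erase hx
  have hne : ∀ u ∈ F, x ≠ u ∧ y ≠ u := fun u hu => ⟨fun h => hxF (h ▸ hu), fun h => hyF (h ▸ hu)⟩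
  have adj : ∀ u ∈ F, dg G F u < b u + 1 → G.Adj y u := fun u hu hlu => S.adj y hy u hu hly hlu
  -- two low neighbours
  have caseB : ∀ z ∈ F, dg G F z < b z + 1 → ∀ w ∈ F, dg G F w < b w + 1 → G.Adj w z →
      ∀ w' ∈ F, dg G F w' < b w' + 1 → G.Adj w' z → w = w' := by
    intro z hz hlz w hw hlw hwz w' hw' hlw' hwz'
    by_contra hww
    have h0 := (hL z hz hlz).1
    have hxz : ¬ G.Adj x z := by
      intro hxz
      have hyx : ¬ G.Adj y x := by
        intro hyx
        have := H.K z y w w' x (hne z hz).2.symm hww (hne w hw).1.symm (hne w' hw').1.symm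
          hwz.symm hwz'.symm hxz.symm (adj w hw hlw) (adj w' hw' hlw') hyx
        omega
      have e0 : ad G x y = 0 := by simp [ad, G.adj_comm x y, hyx]
      have e1 := dg_erase G hy x
      have hxC := Finset.mem_of_mem_erase hx
      have hlow : dg G Fᶜ x < a x + h x := by omega
      have e2 := (S.dY x hxC hlow).1
      have := H.K x y z w w' hxy hwz.ne.symm hwz'.ne.symm hww hxz
        (S.adj x hxC w hw hlow hlw) (S.adj x hxC w' hw' hlow hlw')
        (adj z hz hlz) (adj w hw hlw) (adj w' hw' hlw')
      omega
    obtain ⟨hyx, hk⟩ := T.key H hx hlx hz hlz hxz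
    have := H.K z x y w w' (hne z hz).1.symm (hne w hw).2 (hne w' hw').2 hww
      (adj z hz hlz).symm hwz.symm hwz'.symm hyx.symm (hk w hw hlw hwz).1.symm
      (hk w' hw' hlw' hwz').1.symm
    omega
  have caseA : ∀ z ∈ F, dg G F z < b z + 1 → ∀ w ∈ F, dg G F w < b w + 1 → G.Adj w z →
      ∀ t ∈ F, G.Adj t z → G.Adj t w → dg G F t = b t + 1 → ¬ G.Adj x z → False := by
    intro z hz hlz w hw hlw hwz t ht htz htw htd hxz
    have h0 := (hL z hz hlz).1
    have h0w := (hL w hw hlw).1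
    obtain ⟨hyx, hk⟩ := T.key H hx hlx hz hlz hxz
    obtain ⟨hwx, hk2⟩ := hk w hw hlw hwz
    rcases hk2 t ht htz.ne htw.symm htz htd with hty | htx
    · have := H.K w y z x t (hne w hw).2.symm (hne z hz).1.symm htz.ne.symm (hne t ht).1
        hwz hwx htw.symm (adj z hz hlz) hyx hty.symm
      omega
    · have := H.K z x y w t (hne z hz).1.symm (hne w hw).2 (hne t ht).2 htw.ne.symm
        (adj z hz hlz).symm hwz.symm htz.symm hyx.symm hwx.symm htx.symm
      omega
  obtain ⟨w, hw, hlw, hwz⟩ := S.nbr H hz hlz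
  have hwd := (S.dL w hw hlw).1
  have hzd := (S.dL z hz hlz).1
  -- the vertex t
  have hn2 : none G b ((F.erase z).erase w) :=
    none_mono G (S.bad z hz hlz) (Finset.erase_subset _ _)
  have hne2 : ((F.erase z).erase w).Nonempty := by
    by_contra hE
    rw [Finset.not_nonempty_iff_eq_empty] at hE
    have e1 := dg_le_erase G F z z
    have e2 := dg_le_erase G (F.erase z) w z
    have e3 := ad_le G z w
    have e4 : dg G ∅ z = 0 := by simp [dg]
    have e5 := H.hb z
    have e6 := (hL z hz hlz).1
    rw [hE, e4] at e2
    rw [ad_self] at e1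
    omega
  obtain ⟨t, ht, hlt⟩ := none_low G hn2 hne2
  have htw := Finset.ne_of_mem_erase ht
  have htz := Finset.ne_of_mem_erase (Finset.mem_of_mem_erase ht)
  have htF := Finset.mem_of_mem_erase (Finset.mem_of_mem_erase ht)
  have e1 := dg_erase G hz t
  have e2 := dg_erase G (Finset.mem_erase.mpr ⟨hwz.ne, hw⟩) t
  have e3 := ad_le G t z
  have e4 := ad_le G t w
  have htL : ¬ dg G F t < b t + 1 := by
    intro hlt'
    have htd := (S.dL t htF hlt').1
    by_cases htz' : G.Adj t z
    · exact htw (caseB z hz hlz t htF hlt' htz' w hw hlw hwz)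
    · have : ad G t z = 0 := by simp [ad, htz']
      have htw' : G.Adj t w := (ad_eq_one G).mp (by omega)
      exact htz (caseB w hw hlw t htF hlt' htw' z hz hlz hwz.symm)
  have htz' : G.Adj t z := (ad_eq_one G).mp (by omega)
  have htw' : G.Adj t w := (ad_eq_one G).mp (by omega)
  have htd : dg G F t = b t + 1 := by omega
  by_cases hxz : G.Adj x z
  · by_cases hxw : G.Adj x w
    · have := H.K z w y t x hwz.ne.symm (hne t htF).2 hxy.symm (hne t htF).1.symm
        (adj z hz hlz).symm htz'.symm hxz.symm (adj w hw hlw).symm htw'.symm hxw.symm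
      have := (hL z hz hlz).1
      omega
    · exact caseA w hw hlw z hz hlz hwz.symm t htF htw' htz' htd hxw
  · exact caseA z hz hlz w hw hlw hwz t htF htz' htw' htd hxz

end KP

lemma memCopy_of {V : Type*} {G : SimpleGraph V} {p q r s t : V} (hpq : p ≠ q) (hrs : r ≠ s)
    (hrt : r ≠ t) (hst : s ≠ t) (pr : G.Adj p r) (ps : G.Adj p s) (pt : G.Adj p t)
    (qr : G.Adj q r) (qs : G.Adj q s) (qt : G.Adj q t) :
    MemCopy (completeBipartiteGraph (Fin 2) (Fin 3)) G p := by
  have hpp : ∀ i : Fin 2, ∀ j : Fin 3, G.Adj (![p, q] i) (![r, s, t] j) := by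
    intro i j
    fin_cases i <;> fin_cases j <;> assumption
  refine ⟨Sum.elim ![p, q] ![r, s, t], ?_, ?_, ⟨Sum.inl 0, rfl⟩⟩
  · refine Function.Injective.sumElim ?_ ?_ fun i j => (hpp i j).ne
    · intro i j hij
      fin_cases i <;> fin_cases j <;> simp [hpq, hpq.symm] at hij ⊢
    · intro i j hij
      fin_cases i <;> fin_cases j <;>
        simp [hrs, hrt, hst, hrs.symm, hrt.symm, hst.symm] at hij ⊢
  · rintro (i | i) (j | j) hij
    · simp at hij
    · exact hpp i j
    · exact (hpp j i).symm
    · simp at hij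

/-- Main theorem, part (ii): here `T₁` is the set of vertices lying in a subgraph of `G`
isomorphic to `K_{2,3}`, `T₀` its complement, and `h(u) = 1` on `T₁`, `h(u) = 0` on `T₀`. -/
theorem main_part_ii {V : Type*} [Fintype V] [DecidableEq V]
    (G : SimpleGraph V) [DecidableRel G.Adj] (hcard : 5 ≤ Fintype.card V)
    (a b : V → ℕ)
    (hdeg1 : ∀ u : V, MemCopy (completeBipartiteGraph (Fin 2) (Fin 3)) G u →
      a u + b u + 1 ≤ G.degree u)
    (hmin1 : ∀ u : V, MemCopy (completeBipartiteGraph (Fin 2) (Fin 3)) G u →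
      1 ≤ a u ∧ 1 ≤ b u)
    (hdeg0 : ∀ u : V, ¬ MemCopy (completeBipartiteGraph (Fin 2) (Fin 3)) G u →
      a u + b u ≤ G.degree u)
    (hmin0 : ∀ u : V, ¬ MemCopy (completeBipartiteGraph (Fin 2) (Fin 3)) G u →
      2 ≤ a u ∧ 2 ≤ b u) :
    ∃ A B : Finset V, A.Nonempty ∧ B.Nonempty ∧ Disjoint A B ∧ A ∪ B = Finset.univ ∧
      (∀ u ∈ A, a u ≤ (A.filter (G.Adj u)).card) ∧
      (∀ v ∈ B, b v ≤ (B.filter (G.Adj v)).card) := by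
  classical
  by_contra hcon
  set K := completeBipartiteGraph (Fin 2) (Fin 3) with hKdef
  let h : V → ℕ := fun u => if MemCopy K G u then 1 else 0
  have ht : ∀ u, MemCopy K G u → h u = 1 := fun u hu => if_pos hu
  have hf : ∀ u, ¬ MemCopy K G u → h u = 0 := fun u hu => if_neg hu
  have hcase : ∀ u, h u ≤ 1 ∧ 2 ≤ a u + h u ∧ 2 ≤ b u + h u ∧ a u + b u + h u ≤ G.degree u := by
    intro u
    by_cases hu : MemCopy K G u
    · have h1 := hdeg1 u hu
      have h2 := hmin1 u hu
      rw [ht u hu]; omega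
    · have h1 := hdeg0 u hu
      have h2 := hmin0 u hu
      rw [hf u hu]; omega
  refine KP.Hyp.false (G := G) (a := a) (b := b) (h := h)
    ⟨fun u => (hcase u).1, fun u => (hcase u).2.1, fun u => (hcase u).2.2.1,
      fun u => (hcase u).2.2.2, ?_, ?_, ?_⟩
  · intro p q r s t hpq hrs hrt hst pr ps pt qr qs qt
    exact ht p (memCopy_of hpq hrs hrt hst pr ps pt qr qs qt)
  · intro S T hS hT hd hfS hfT
    obtain ⟨A, hA, hmax⟩ := Finset.exists_max_image
      (Finset.univ.filter fun A : Finset V => KP.feas G a A ∧ A.Nonempty ∧ Disjoint A T)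
      Finset.card ⟨S, by simp [hS, hd, hfS]⟩
    simp only [Finset.mem_filter, Finset.mem_univ, true_and] at hA hmax
    obtain ⟨hAf, hAn, hAT⟩ := hA
    have hTA : T ⊆ Aᶜ := fun x hx =>
      Finset.mem_compl.mpr fun hxA => Finset.disjoint_left.mp hAT hxA hx
    refine hcon ⟨A, Aᶜ, hAn, hT.mono hTA, disjoint_compl_right, Finset.union_compl A, hAf, ?_⟩
    by_contra! hlow
    obtain ⟨v, hv, hlv⟩ := hlow
    change KP.dg G Aᶜ v < b v at hlv
    have hvA : v ∉ A := by simpa using hv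
    have hvT : v ∉ T := by
      intro hvT
      have h1 := hfT v hvT
      have h2 := KP.dg_mono G hTA v
      omega
    have hnew := hmax (insert v A) ⟨?_, by simp, by
      rw [Finset.disjoint_insert_left]; exact ⟨hvT, hAT⟩⟩
    · rw [Finset.card_insert_of_notMem hvA] at hnew
      omega
    · intro u hu
      rw [KP.dg_insert G hvA]
      rcases Finset.mem_insert.mp hu with rfl | hu
      · have h1 := KP.dg_compl G A u
        have h2 := (hcase u).2.2.2
        omega
      · have := hAf u hu
        omega
  · exact Fintype.card_pos_iff.mp (by omega)
end
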